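/- For real s ≥ 0, Σ' over triples (ω₁,ω₂,ω₃) of nonzero Gaussian integers with ω₁+ω₂+ω₃=0 and ω₁, ω₂ linearly independent over ℝ, of |det(ω₁,ω₂)|^{-s}/(|ω₁|²|ω₂|²|ω₃|²), equals 6π·ζ(s+3)·ζ(s+2). Here det(ω₁,ω₂) = Im(ω̄₁ω₂) for ω viewed as vectors in ℝ². -/

import Mathlib

noncomputable def nsq (p : ℤ × ℤ) : ℝ := (p.1 : ℝ) ^ 2 + (p.2 : ℝ) ^ 2

section Helpers

open Filter Topology

/-- A binary quadratic form `A x² + 2 h x y + B y²` is encoded as `(A, h, B)`; this is its value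
at `(1, 1)`. -/
def formMid (q : ℤ × ℤ × ℤ) : ℤ := q.1 + 2 * q.2.1 + q.2.2

/-- The form in the basis `(u, u + v)` (for `false`) or `(u + v, v)` (for `true`). -/
def formChild (b : Bool) (q : ℤ × ℤ × ℤ) : ℤ × ℤ × ℤ :=
  if b then (formMid q, q.2.1 + q.2.2, q.2.2) else (q.1, q.1 + q.2.1, formMid q)

lemma formChild_false (q : ℤ × ℤ × ℤ) : formChild false q = (q.1, q.1 + q.2.1, formMid q) := rfl

lemma formChild_true (q : ℤ × ℤ × ℤ) : formChild true q = (formMid q, q.2.1 + q.2.2, q.2.2) := rfl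

/-- The form reached from `q` along a path in the Stern-Brocot tree, the last step coming first. -/
def formAt (q : ℤ × ℤ × ℤ) : List Bool → ℤ × ℤ × ℤ
  | [] => q
  | b :: l => formChild b (formAt q l)

/-- Positive definite forms of determinant `n ^ 2`. -/
def IsPosForm (n : ℤ) (q : ℤ × ℤ × ℤ) : Prop :=
  0 < q.1 ∧ 0 < q.2.2 ∧ q.1 * q.2.2 = q.2.1 ^ 2 + n ^ 2

/-- The angle between the two basis vectors. -/
noncomputable def formAngle (n : ℤ) (q : ℤ × ℤ × ℤ) : ℝ := Complex.arg ⟨q.2.1, n⟩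

/-- The quantity `θ - sin θ cos θ`, where `θ` is the angle between the basis vectors. -/
noncomputable def formSegment (n : ℤ) (q : ℤ × ℤ × ℤ) : ℝ :=
  formAngle n q - n * q.2.1 / (q.1 * q.2.2)

/-- The contribution of a superbase to the lattice sum. -/
noncomputable def formTerm (q : ℤ × ℤ × ℤ) : ℝ := 1 / ((q.1 * q.2.2 * formMid q : ℤ) : ℝ)

lemma IsPosForm.formMid_pos {n : ℤ} (hn : 0 < n) {q : ℤ × ℤ × ℤ} (hq : IsPosForm n q) :
    0 < formMid q := by
  obtain ⟨h1, h2, h3⟩ := hq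
  have : 0 < q.1 * formMid q := by unfold formMid; nlinarith [sq_nonneg (q.1 + q.2.1), pow_pos hn 2]
  exact pos_of_mul_pos_right this h1.le

lemma IsPosForm.formChild {n : ℤ} (hn : 0 < n) {q : ℤ × ℤ × ℤ} (hq : IsPosForm n q) (b : Bool) :
    IsPosForm n (formChild b q) := by
  have hm := hq.formMid_pos hn
  obtain ⟨h1, h2, h3⟩ := hq
  cases b
  · exact ⟨h1, hm, by simp only [_root_.formChild, formMid]; norm_num; linarith⟩
  · exact ⟨hm, h2, by simp only [_root_.formChild, formMid]; norm_num; linarith⟩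

lemma IsPosForm.formAt {n : ℤ} (hn : 0 < n) {q : ℤ × ℤ × ℤ} (hq : IsPosForm n q) (l : List Bool) :
    IsPosForm n (formAt q l) := by
  induction l with
  | nil => exact hq
  | cons b l ih => exact ih.formChild hn b

lemma IsPosForm.le_formAt {n : ℤ} (hn : 0 < n) {q : ℤ × ℤ × ℤ} (hq : IsPosForm n q)
    (l : List Bool) : q.2.1 + l.length ≤ (_root_.formAt q l).2.1 := by
  induction l with
  | nil => simp [_root_.formAt]
  | cons b l ih =>
    obtain ⟨h1, h2, -⟩ := hq.formAt hn l
    cases b <;> simp [_root_.formAt, _root_.formChild] <;> linarith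

lemma Complex.arg_mul_of_im_pos {z w : ℂ} (hz : 0 < z.im) (hw : 0 < w.im)
    (hzw : 0 < (z * w).im) : (z * w).arg = z.arg + w.arg := by
  have hz0 : z ≠ 0 := by rintro rfl; simp at hz
  have hw0 : w ≠ 0 := by rintro rfl; simp at hw
  rw [Complex.arg_mul_eq_add_arg_iff hz0 hw0]
  have h1 := Complex.arg_nonneg_iff.2 hz.le
  have h2 := Complex.arg_nonneg_iff.2 hw.le
  refine ⟨by linarith [Real.pi_pos], ?_⟩
  by_contra! h
  have h3 : 0 < Real.sin (z.arg + w.arg) := by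
    rw [Real.sin_add, Complex.sin_arg, Complex.sin_arg, Complex.cos_arg hz0, Complex.cos_arg hw0]
    have e : z.im / ‖z‖ * (w.re / ‖w‖) + z.re / ‖z‖ * (w.im / ‖w‖) = (z * w).im / (‖z‖ * ‖w‖) := by
      rw [Complex.mul_im]; ring
    rw [e]
    positivity
  have h4 : 0 ≤ Real.sin (z.arg + w.arg - Real.pi) :=
    Real.sin_nonneg_of_nonneg_of_le_pi (by linarith)
      (by linarith [Complex.arg_le_pi z, Complex.arg_le_pi w])
  rw [Real.sin_sub_pi] at h4
  linarith

lemma formAngle_formChild {n : ℤ} (hn : 0 < n) {q : ℤ × ℤ × ℤ} (hq : IsPosForm n q) :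
    formAngle n (formChild false q) + formAngle n (formChild true q) = formAngle n q := by
  have hm : (0 : ℝ) < formMid q := by exact_mod_cast hq.formMid_pos hn
  have hn' : (0 : ℝ) < n := by exact_mod_cast hn
  have h3 : (q.1 * q.2.2 : ℝ) = q.2.1 ^ 2 + n ^ 2 := by exact_mod_cast hq.2.2
  have e : (⟨(q.1 + q.2.1 : ℤ), n⟩ : ℂ) * ⟨(q.2.1 + q.2.2 : ℤ), n⟩
      = ((formMid q : ℝ) : ℂ) * ⟨q.2.1, n⟩ := by
    apply Complex.ext <;> simp [formMid] <;> linarith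
  simp only [formAngle, formChild_false, formChild_true]
  rw [← Complex.arg_real_mul ⟨(q.2.1 : ℝ), n⟩ hm, ← e, Complex.arg_mul_of_im_pos]
  · exact hn'
  · exact hn'
  · rw [e]; simp; positivity

lemma formSegment_sub_formChild {n : ℤ} (hn : 0 < n) {q : ℤ × ℤ × ℤ} (hq : IsPosForm n q) :
    formSegment n q - (formSegment n (formChild false q) + formSegment n (formChild true q))
      = 2 * n ^ 3 * formTerm q := by
  have hm : (0 : ℝ) < formMid q := by exact_mod_cast hq.formMid_pos hn
  have h1 : (0 : ℝ) < q.1 := by exact_mod_cast hq.1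
  have h2 : (0 : ℝ) < q.2.2 := by exact_mod_cast hq.2.1
  have h3 : (q.1 * q.2.2 : ℝ) = q.2.1 ^ 2 + n ^ 2 := by exact_mod_cast hq.2.2
  have h4 : (n * (q.1 + q.2.1 : ℤ) / (q.1 * formMid q) +
      n * (q.2.1 + q.2.2 : ℤ) / (formMid q * q.2.2) - n * q.2.1 / (q.1 * q.2.2) : ℝ)
      = 2 * n ^ 3 * formTerm q := by
    simp only [formTerm]
    push_cast
    field_simp
    simp only [formMid]
    push_cast
    linear_combination 2 * h3
  have h5 := formAngle_formChild hn hq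
  simp only [formSegment]
  rw [← h4, ← h5, formChild_false, formChild_true]
  ring

lemma IsPosForm.sin_mul_cos {n : ℤ} (hn : 0 < n) {q : ℤ × ℤ × ℤ} (hq : IsPosForm n q) :
    Real.sin (formAngle n q) * Real.cos (formAngle n q) = n * q.2.1 / (q.1 * q.2.2) := by
  have h3 : (q.1 * q.2.2 : ℝ) = q.2.1 ^ 2 + n ^ 2 := by exact_mod_cast hq.2.2
  have h0 : (⟨q.2.1, n⟩ : ℂ) ≠ 0 := by
    intro h; have := congrArg Complex.im h; simp at this; omega
  rw [formAngle, Complex.sin_arg, Complex.cos_arg h0, div_mul_div_comm, ← sq, Complex.sq_norm,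
    Complex.normSq_mk, h3]
  ring_nf

lemma formAngle_pos {n : ℤ} (hn : 0 < n) (q : ℤ × ℤ × ℤ) : 0 < formAngle n q := by
  have hn' : (0 : ℝ) < n := by exact_mod_cast hn
  refine lt_of_le_of_ne (Complex.arg_nonneg_iff.2 hn'.le) fun h => ?_
  have := (Complex.arg_eq_zero_iff.1 h.symm).2
  simp at this
  omega

lemma formSegment_nonneg {n : ℤ} (hn : 0 < n) {q : ℤ × ℤ × ℤ} (hq : IsPosForm n q) :
    0 ≤ formSegment n q := by
  rw [formSegment, ← hq.sin_mul_cos hn]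
  have := Real.sin_le (x := 2 * formAngle n q) (by linarith [formAngle_pos hn q])
  rw [Real.sin_two_mul] at this
  linarith

lemma formSegment_le {n : ℤ} (hn : 0 < n) {q : ℤ × ℤ × ℤ} (hq : IsPosForm n q) {m : ℝ}
    (hm : 0 < m) (hmq : m ≤ q.2.1) :
    formSegment n q ≤ (Real.pi * n / m) ^ 2 * formAngle n q := by
  have hθ := formAngle_pos hn q
  have hn' : (0 : ℝ) < n := by exact_mod_cast hn
  have hq1 : (0 : ℝ) < q.2.1 := hm.trans_le hmq
  have hle : formAngle n q ≤ Real.pi / 2 :=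
    (le_abs_self _).trans (Complex.abs_arg_le_pi_div_two_iff.2 hq1.le)
  have h1 := Real.mul_le_sin hθ.le hle
  have h2 : Real.sin (formAngle n q) ≤ n / m := by
    rw [formAngle, Complex.sin_arg]
    have : m ≤ ‖(⟨q.2.1, n⟩ : ℂ)‖ :=
      hmq.trans ((le_abs_self _).trans (Complex.abs_re_le_norm ⟨q.2.1, n⟩))
    exact div_le_div_of_nonneg_left hn'.le hm this
  have h3 : 2 * formAngle n q ≤ Real.pi * n / m := by
    have := h1.trans h2
    rw [div_mul_eq_mul_div, div_le_iff₀ Real.pi_pos] at this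
    calc _ ≤ _ := this
      _ = _ := by ring
  have h4 := Real.sin_gt_sub_cube (x := 2 * formAngle n q) (by linarith)
  rw [Real.sin_two_mul] at h4
  rw [formSegment, ← hq.sin_mul_cos hn]
  have h5 : (2 * formAngle n q) ^ 2 ≤ (Real.pi * n / m) ^ 2 := by gcongr
  nlinarith [mul_le_mul_of_nonneg_right h5 hθ.le, pow_pos hθ 3]

lemma sum_level_succ {M : Type*} [AddCommMonoid M] (G : List Bool → M) (k : ℕ) :
    ∑ c : Fin (k + 1) → Bool, G (List.ofFn c)
      = ∑ c : Fin k → Bool, (G (false :: List.ofFn c) + G (true :: List.ofFn c)) := by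
  rw [← (Fin.consEquiv fun _ => Bool).sum_comp, Fintype.sum_prod_type, Fintype.sum_bool, add_comm,
    ← Finset.sum_add_distrib]
  simp [List.ofFn_succ]

lemma sum_level_formAngle {n : ℤ} (hn : 0 < n) {q : ℤ × ℤ × ℤ} (hq : IsPosForm n q) (k : ℕ) :
    ∑ c : Fin k → Bool, formAngle n (formAt q (List.ofFn c)) = formAngle n q := by
  induction k with
  | zero => simp [formAt]
  | succ k ih =>
    rw [sum_level_succ fun l => formAngle n (formAt q l), ← ih]
    exact Finset.sum_congr rfl fun c _ => formAngle_formChild hn (hq.formAt hn _)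

lemma sum_level_formTerm {n : ℤ} (hn : 0 < n) {q : ℤ × ℤ × ℤ} (hq : IsPosForm n q) (k : ℕ) :
    ∑ i ∈ Finset.range k, ∑ c : Fin i → Bool, 2 * n ^ 3 * formTerm (formAt q (List.ofFn c))
      = formSegment n q - ∑ c : Fin k → Bool, formSegment n (formAt q (List.ofFn c)) := by
  induction k with
  | zero => simp [formAt]
  | succ k ih =>
    rw [Finset.sum_range_succ, ih, sum_level_succ fun l => formSegment n (formAt q l),
      Finset.sum_congr rfl fun c _ => (formSegment_sub_formChild hn (hq.formAt hn _)).symm,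
      Finset.sum_sub_distrib]
    exact sub_add_sub_cancel _ _ _

lemma tendsto_sum_level_formSegment {n : ℤ} (hn : 0 < n) {q : ℤ × ℤ × ℤ} (hq : IsPosForm n q) :
    Tendsto (fun k : ℕ => ∑ c : Fin k → Bool, formSegment n (formAt q (List.ofFn c)))
      atTop (𝓝 0) := by
  have hlim : Tendsto (fun k : ℕ => (Real.pi * n / (q.2.1 + k : ℝ)) ^ 2 * formAngle n q)
      atTop (𝓝 0) := by
    have h : Tendsto (fun k : ℕ => (q.2.1 + k : ℝ)) atTop atTop :=
      tendsto_atTop_add_const_left _ _ tendsto_natCast_atTop_atTop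
    simpa using ((tendsto_const_nhds.div_atTop h).pow 2).mul_const (formAngle n q)
  refine squeeze_zero' (Eventually.of_forall fun k => Finset.sum_nonneg fun c _ =>
    formSegment_nonneg hn (hq.formAt hn _)) ?_ hlim
  filter_upwards [eventually_gt_atTop (-q.2.1).toNat] with k hk
  rw [← sum_level_formAngle hn hq k, Finset.mul_sum]
  refine Finset.sum_le_sum fun c _ => formSegment_le hn (hq.formAt hn _) ?_ ?_
  · have : 0 < q.2.1 + (k : ℤ) := by omega
    exact_mod_cast this
  · have := hq.le_formAt hn (List.ofFn c)
    rw [List.length_ofFn] at this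
    exact_mod_cast this

lemma formTerm_nonneg {n : ℤ} (hn : 0 < n) {q : ℤ × ℤ × ℤ} (hq : IsPosForm n q) :
    0 ≤ formTerm q := by
  have := mul_pos (mul_pos hq.1 hq.2.1) (hq.formMid_pos hn)
  have : (0 : ℝ) < (q.1 * q.2.2 * formMid q : ℤ) := by exact_mod_cast this
  rw [formTerm]
  positivity

lemma tsum_formTerm {n : ℤ} (hn : 0 < n) {q : ℤ × ℤ × ℤ} (hq : IsPosForm n q) :
    ∑' l : List Bool, ENNReal.ofReal (formTerm (formAt q l))
      = ENNReal.ofReal (formSegment n q / (2 * n ^ 3)) := by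
  have hn' : (0 : ℝ) < n := by exact_mod_cast hn
  have hpos : ∀ l, 0 ≤ formTerm (formAt q l) := fun l => formTerm_nonneg hn (hq.formAt hn l)
  have hsum : HasSum (fun i : ℕ => ∑ c : Fin i → Bool, formTerm (formAt q (List.ofFn c)))
      (formSegment n q / (2 * n ^ 3)) := by
    rw [hasSum_iff_tendsto_nat_of_nonneg fun i => Finset.sum_nonneg fun c _ => hpos _]
    have h := ((tendsto_sum_level_formSegment hn hq).const_sub (formSegment n q)).div_const
      (2 * (n : ℝ) ^ 3)
    rw [sub_zero] at h
    refine h.congr fun k => ?_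
    rw [← sum_level_formTerm hn hq, div_eq_iff (by positivity)]
    simp only [← Finset.mul_sum]
    ring
  rw [← hsum.tsum_eq, ENNReal.ofReal_tsum_of_nonneg
    (fun i => Finset.sum_nonneg fun c _ => hpos _) hsum.summable,
    ← List.equivSigmaTuple.symm.tsum_eq, ENNReal.tsum_sigma']
  refine tsum_congr fun i => ?_
  rw [ENNReal.ofReal_sum_of_nonneg fun c _ => hpos _, tsum_fintype]
  rfl

/-- The two adjacent sectors spanned by `(u, v)` and `(v, -u)` make up a half plane. -/
lemma tsum_formTerm_add_tsum_formTerm {n A h B : ℤ} (hn : 0 < n) (hq : IsPosForm n (A, h, B)) :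
    ∑' l : List Bool, ENNReal.ofReal (formTerm (formAt (A, h, B) l))
      + ∑' l : List Bool, ENNReal.ofReal (formTerm (formAt (B, -h, A) l))
      = ENNReal.ofReal (Real.pi / (2 * n ^ 3)) := by
  have hn' : (0 : ℝ) < n := by exact_mod_cast hn
  have hq' : IsPosForm n (B, -h, A) := by
    obtain ⟨h1, h2, h3⟩ := hq
    exact ⟨h2, h1, by simp only at h3 ⊢; linarith⟩
  rw [tsum_formTerm hn hq, tsum_formTerm hn hq', ← ENNReal.ofReal_add
    (div_nonneg (formSegment_nonneg hn hq) (by positivity))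
    (div_nonneg (formSegment_nonneg hn hq') (by positivity)), ← add_div]
  congr 2
  have e : (⟨((-h : ℤ) : ℝ), n⟩ : ℂ) = -⟨h, (-n : ℝ)⟩ := by apply Complex.ext <;> simp
  have e' : (⟨h, (-n : ℝ)⟩ : ℂ) = (starRingEnd ℂ) ⟨h, n⟩ := by apply Complex.ext <;> simp
  have e2 : Complex.arg ⟨((-h : ℤ) : ℝ), n⟩ = Real.pi - Complex.arg ⟨h, n⟩ := by
    rw [e, Complex.arg_neg_eq_arg_add_pi_of_im_neg (by simpa using hn'), e', Complex.arg_conj,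
      if_neg]
    · ring
    · exact ne_of_lt (Complex.arg_lt_pi_iff.2 (Or.inr hn'.ne'))
  simp only [formSegment, formAngle, e2]
  push_cast
  ring

/-- The determinant of a pair of vectors `(u, v)`, encoded as `(u₁, u₂, v₁, v₂)`. -/
def pairDet (m : ℤ × ℤ × ℤ × ℤ) : ℤ := m.1 * m.2.2.2 - m.2.1 * m.2.2.1

/-- The Gram matrix of a pair of vectors. -/
def pairGram (m : ℤ × ℤ × ℤ × ℤ) : ℤ × ℤ × ℤ :=
  (m.1 ^ 2 + m.2.1 ^ 2, m.1 * m.2.2.1 + m.2.1 * m.2.2.2, m.2.2.1 ^ 2 + m.2.2.2 ^ 2)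

/-- The pair of linear combinations of the vectors of `M` with coefficients given by `c`. -/
def pairMul (M c : ℤ × ℤ × ℤ × ℤ) : ℤ × ℤ × ℤ × ℤ :=
  (c.1 * M.1 + c.2.1 * M.2.2.1, c.1 * M.2.1 + c.2.1 * M.2.2.2,
    c.2.2.1 * M.1 + c.2.2.2 * M.2.2.1, c.2.2.1 * M.2.1 + c.2.2.2 * M.2.2.2)

/-- The pair `(u, u + v)` (for `false`) or `(u + v, v)` (for `true`). -/
def pairChild : Bool → ℤ × ℤ × ℤ × ℤ → ℤ × ℤ × ℤ × ℤ
  | false, m => (m.1, m.2.1, m.1 + m.2.2.1, m.2.1 + m.2.2.2)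
  | true, m => (m.1 + m.2.2.1, m.2.1 + m.2.2.2, m.2.2.1, m.2.2.2)

/-- The pairs of the Stern-Brocot tree, the last step of the path coming first. -/
def pairAt : List Bool → ℤ × ℤ × ℤ × ℤ
  | [] => (1, 0, 0, 1)
  | b :: l => pairChild b (pairAt l)

/-- Rotation of both vectors by a right angle. -/
def pairRot (m : ℤ × ℤ × ℤ × ℤ) : ℤ × ℤ × ℤ × ℤ := (-m.2.1, m.1, -m.2.2.2, m.2.2.1)

/-- The cyclic permutation of the superbase `(u, v, -u - v)`. -/
def pairCyc (m : ℤ × ℤ × ℤ × ℤ) : ℤ × ℤ × ℤ × ℤ :=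
  (m.2.2.1, m.2.2.2, -m.1 - m.2.2.1, -m.2.1 - m.2.2.2)

/-- The pair `(v, -u)`. -/
def pairTurn (m : ℤ × ℤ × ℤ × ℤ) : ℤ × ℤ × ℤ × ℤ := (m.2.2.1, m.2.2.2, -m.1, -m.2.1)

lemma pairDet_pairMul (M c : ℤ × ℤ × ℤ × ℤ) :
    pairDet (pairMul M c) = pairDet M * pairDet c := by
  simp only [pairDet, pairMul]; ring

lemma pairDet_pairChild (b : Bool) (m : ℤ × ℤ × ℤ × ℤ) :
    pairDet (pairChild b m) = pairDet m := by
  cases b <;> simp only [pairDet, pairChild] <;> ring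

lemma pairDet_pairAt (l : List Bool) : pairDet (pairAt l) = 1 := by
  induction l with
  | nil => rfl
  | cons b l ih => rw [pairAt, pairDet_pairChild, ih]

lemma pairDet_pairRot (m : ℤ × ℤ × ℤ × ℤ) : pairDet (pairRot m) = pairDet m := by
  simp only [pairDet, pairRot]; ring

lemma pairDet_pairCyc (m : ℤ × ℤ × ℤ × ℤ) : pairDet (pairCyc m) = pairDet m := by
  simp only [pairDet, pairCyc]; ring

lemma pairMul_pairRot (M c : ℤ × ℤ × ℤ × ℤ) :
    pairMul M (pairRot c) = pairMul (pairTurn M) c := by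
  ext <;> simp only [pairMul, pairRot, pairTurn] <;> ring

lemma pairMul_pairCyc (M c : ℤ × ℤ × ℤ × ℤ) :
    pairMul M (pairCyc c) = pairCyc (pairMul M c) := by
  ext <;> simp only [pairMul, pairCyc] <;> ring

lemma pairMul_pairChild (M c : ℤ × ℤ × ℤ × ℤ) (b : Bool) :
    pairMul M (pairChild b c) = pairChild b (pairMul M c) := by
  cases b <;> ext <;> simp only [pairMul, pairChild] <;> ring

lemma pairGram_pairChild (m : ℤ × ℤ × ℤ × ℤ) (b : Bool) :
    pairGram (pairChild b m) = formChild b (pairGram m) := by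
  cases b <;> ext <;>
    simp only [pairGram, pairChild, formChild_false, formChild_true, formMid] <;> ring

lemma pairGram_pairMul_pairAt (M : ℤ × ℤ × ℤ × ℤ) (l : List Bool) :
    pairGram (pairMul M (pairAt l)) = formAt (pairGram M) l := by
  induction l with
  | nil => simp [pairAt, formAt, pairMul]
  | cons b l ih => rw [pairAt, formAt, pairMul_pairChild, pairGram_pairChild, ih]

lemma formTerm_pairGram_pairCyc (m : ℤ × ℤ × ℤ × ℤ) :
    formTerm (pairGram (pairCyc m)) = formTerm (pairGram m) := by
  simp only [formTerm, pairGram, pairCyc, formMid]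
  congr 2
  ring

lemma isPosForm_pairGram {m : ℤ × ℤ × ℤ × ℤ} (hm : 0 < pairDet m) :
    IsPosForm (pairDet m) (pairGram m) := by
  obtain ⟨a, b, c, d⟩ := m
  simp only [pairDet] at hm
  simp only [IsPosForm, pairGram, pairDet]
  refine ⟨?_, ?_, by ring⟩
  · by_contra! h
    have ha : a = 0 := by nlinarith [sq_nonneg a, sq_nonneg b]
    have hb : b = 0 := by nlinarith [sq_nonneg a, sq_nonneg b]
    simp [ha, hb] at hm
  · by_contra! h
    have hc : c = 0 := by nlinarith [sq_nonneg c, sq_nonneg d]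
    have hd : d = 0 := by nlinarith [sq_nonneg c, sq_nonneg d]
    simp [hc, hd] at hm

/-- The entries are nonnegative and no row or column vanishes. -/
def PairNonneg (m : ℤ × ℤ × ℤ × ℤ) : Prop :=
  (0 ≤ m.1 ∧ 0 ≤ m.2.1 ∧ 0 ≤ m.2.2.1 ∧ 0 ≤ m.2.2.2) ∧
    0 < m.1 + m.2.1 ∧ 0 < m.2.2.1 + m.2.2.2 ∧ 0 < m.1 + m.2.2.1 ∧ 0 < m.2.1 + m.2.2.2

lemma pairNonneg_pairAt (l : List Bool) : PairNonneg (pairAt l) := by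
  induction l with
  | nil => simp [PairNonneg, pairAt]
  | cons b l ih =>
    unfold PairNonneg at ih
    cases b <;> simp only [PairNonneg, pairAt, pairChild] <;> omega

lemma pairAt_injective : Function.Injective pairAt := by
  intro l
  induction l with
  | nil =>
    rintro (_ | ⟨b, l'⟩) h
    · rfl
    · have h' := pairNonneg_pairAt l'
      unfold PairNonneg at h'
      cases b <;> simp only [pairAt, pairChild, Prod.mk.injEq] at h <;> omega
  | cons b l ih =>
    have h₁ := pairNonneg_pairAt l
    unfold PairNonneg at h₁
    rintro (_ | ⟨b', l'⟩) h
    · cases b <;> simp only [pairAt, pairChild, Prod.mk.injEq] at h <;> omega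
    · have h₂ := pairNonneg_pairAt l'
      unfold PairNonneg at h₂
      have : b = b' ∧ pairAt l = pairAt l' := by
        cases b <;> cases b' <;> simp only [pairAt, pairChild, Prod.mk.injEq] at h <;>
          simp only [Prod.ext_iff, true_and, reduceCtorEq, false_and] <;> omega
      rw [this.1, ih this.2]

lemma exists_pairAt_eq (m : ℤ × ℤ × ℤ × ℤ) (hdet : pairDet m = 1)
    (h0 : 0 ≤ m.1 ∧ 0 ≤ m.2.1 ∧ 0 ≤ m.2.2.1 ∧ 0 ≤ m.2.2.2) : ∃ l, pairAt l = m := by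
  induction hN : (m.1 + m.2.1 + m.2.2.1 + m.2.2.2).toNat using Nat.strong_induction_on
    generalizing m with
  | _ N ih =>
    obtain ⟨a, b, c, d⟩ := m
    simp only [pairDet] at hdet h0 hN
    obtain ⟨ha, hb, hc, hd⟩ := h0
    have hab : 0 < a + b := by
      by_contra! h
      have h1 : a = 0 := by omega
      have h2 : b = 0 := by omega
      simp [h1, h2] at hdet
    have hcd : 0 < c + d := by
      by_contra! h
      have h1 : c = 0 := by omega
      have h2 : d = 0 := by omega
      simp [h1, h2] at hdet
    by_cases h1 : c ≤ a ∧ d ≤ b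
    · obtain ⟨l, hl⟩ := ih (a - c + (b - d) + c + d).toNat (by omega) (a - c, b - d, c, d)
        (by simp only [pairDet]; linarith) (by simp only; omega) rfl
      exact ⟨true :: l, by simp [pairAt, hl, pairChild]⟩
    by_cases h2 : a ≤ c ∧ b ≤ d
    · obtain ⟨l, hl⟩ := ih (a + b + (c - a) + (d - b)).toNat (by omega) (a, b, c - a, d - b)
        (by simp only [pairDet]; linarith) (by simp only; omega) rfl
      exact ⟨false :: l, by simp [pairAt, hl, pairChild]⟩
    have h3 : (a < c ∧ d < b) ∨ (b < d ∧ c < a) := by omega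
    rcases h3 with ⟨h3, h4⟩ | ⟨h3, h4⟩
    · nlinarith
    · have hb0 : b = 0 := by nlinarith
      have hc0 : c = 0 := by nlinarith
      subst hb0 hc0
      have ha1 : a = 1 := by nlinarith
      have hd1 : d = 1 := by nlinarith
      exact ⟨[], by simp [pairAt, ha1, hd1]⟩

lemma det_ne_one_of_mul_pos_of_mul_neg {a b c d : ℤ} (hac : 0 < a * c) (hbd : b * d < 0) :
    a * d - b * c ≠ 1 ∧ b * c - a * d ≠ 1 := by
  rcases pos_and_pos_or_neg_and_neg_of_mul_pos hac with ⟨h1, h2⟩ | ⟨h1, h2⟩ <;>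
  rcases mul_neg_iff.1 hbd with ⟨h3, h4⟩ | ⟨h3, h4⟩ <;>
  constructor <;> intro h <;> nlinarith

lemma mul_pos_of_mul_neg_of_mul_neg {a b c : ℤ} (hab : a * b < 0) (hbc : b * c < 0) :
    0 < a * c := by
  rcases mul_neg_iff.1 hab with ⟨h1, h2⟩ | ⟨h1, h2⟩ <;>
  rcases mul_neg_iff.1 hbc with ⟨h3, h4⟩ | ⟨h3, h4⟩ <;> nlinarith

lemma exists_pairCyc_mul_nonneg (m : ℤ × ℤ × ℤ × ℤ) (hdet : pairDet m = 1) :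
    ∃ j : Fin 3, 0 ≤ (pairCyc^[j] m).1 * (pairCyc^[j] m).2.2.1 ∧
      0 ≤ (pairCyc^[j] m).2.1 * (pairCyc^[j] m).2.2.2 := by
  by_contra! h
  have h0 := h 0
  have h1 := h 1
  have h2 := h 2
  obtain ⟨a, b, c, d⟩ := m
  simp only [pairCyc, Fin.coe_ofNat_eq_mod, Nat.zero_mod, Nat.one_mod, Nat.reduceMod,
    Function.iterate_succ, Function.iterate_zero, Function.comp_apply, id_eq] at h0 h1 h2
  simp only [pairDet] at hdet
  obtain ⟨e, he⟩ : ∃ e, e = -a - c := ⟨_, rfl⟩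
  obtain ⟨f, hf⟩ : ∃ f, f = -b - d := ⟨_, rfl⟩
  have hdet1 : c * f - d * e = 1 := by rw [he, hf]; linarith
  have hdet2 : e * b - f * a = 1 := by rw [he, hf]; linarith
  rw [← he, ← hf] at h1
  rw [← he, ← hf, show -c - e = a by rw [he]; ring, show -d - f = b by rw [hf]; ring] at h2
  rcases lt_or_ge (a * c) 0 with hac | hac <;> rcases lt_or_ge (c * e) 0 with hce | hce
  · have hea := mul_pos_of_mul_neg_of_mul_neg hac hce
    rw [mul_comm] at hea
    exact (det_ne_one_of_mul_pos_of_mul_neg hea (h2 hea.le)).1 hdet2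
  · rcases lt_or_ge (e * a) 0 with hea | hea
    · have := mul_pos_of_mul_neg_of_mul_neg hea hac
      rw [mul_comm] at this
      exact (det_ne_one_of_mul_pos_of_mul_neg this (h1 hce)).1 hdet1
    · have := mul_pos_of_mul_neg_of_mul_neg (h1 hce) (h2 hea)
      rw [mul_comm] at this
      exact (det_ne_one_of_mul_pos_of_mul_neg this hac).2 hdet
  · rcases lt_or_ge (e * a) 0 with hea | hea
    · have := mul_pos_of_mul_neg_of_mul_neg hce hea
      rw [mul_comm] at this
      exact (det_ne_one_of_mul_pos_of_mul_neg this (h0 hac)).1 hdet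
    · have := mul_pos_of_mul_neg_of_mul_neg (h2 hea) (h0 hac)
      rw [mul_comm] at this
      exact (det_ne_one_of_mul_pos_of_mul_neg this hce).2 hdet1
  · have := mul_pos_of_mul_neg_of_mul_neg (h0 hac) (h1 hce)
    rw [mul_comm] at this
    rcases lt_or_ge (e * a) 0 with hea | hea
    · exact (det_ne_one_of_mul_pos_of_mul_neg this hea).2 hdet2
    · exact absurd (h2 hea) this.not_gt

lemma exists_pairRot_nonneg (m : ℤ × ℤ × ℤ × ℤ) (h1 : 0 ≤ m.1 * m.2.2.1)
    (h2 : 0 ≤ m.2.1 * m.2.2.2) :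
    ∃ k : Fin 4, 0 ≤ (pairRot^[k] m).1 ∧ 0 ≤ (pairRot^[k] m).2.1 ∧
      0 ≤ (pairRot^[k] m).2.2.1 ∧ 0 ≤ (pairRot^[k] m).2.2.2 := by
  rcases mul_nonneg_iff.1 h1 with h1 | h1 <;> rcases mul_nonneg_iff.1 h2 with h2 | h2
  · exact ⟨0, by simp; omega⟩
  · exact ⟨1, by simp [pairRot]; omega⟩
  · exact ⟨3, by simp [pairRot]; omega⟩
  · exact ⟨2, by simp [pairRot]; omega⟩

lemma injective_pairRot_pairCyc_pairAt :
    Function.Injective fun x : Fin 4 × Fin 3 × List Bool =>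
      pairRot^[x.1] (pairCyc^[x.2.1] (pairAt x.2.2)) := by
  rintro ⟨k, j, l⟩ ⟨k', j', l'⟩ h
  simp only at h
  have h₁ := pairNonneg_pairAt l
  have h₂ := pairNonneg_pairAt l'
  suffices k = k' ∧ j = j' ∧ pairAt l = pairAt l' by
    rw [this.1, this.2.1, pairAt_injective this.2.2]
  generalize pairAt l = m at *
  generalize pairAt l' = m' at *
  obtain ⟨a, b, c, d⟩ := m
  obtain ⟨a', b', c', d'⟩ := m'
  obtain ⟨k, hk⟩ := k
  obtain ⟨j, hj⟩ := j
  obtain ⟨k', hk'⟩ := k'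
  obtain ⟨j', hj'⟩ := j'
  unfold PairNonneg at h₁ h₂
  simp only [Fin.mk.injEq, Prod.mk.injEq] at h h₁ h₂ ⊢
  interval_cases k <;> interval_cases j <;> interval_cases k' <;> interval_cases j' <;>
    simp only [pairRot, pairCyc, Function.iterate_succ, Function.iterate_zero, Function.comp_apply,
      id_eq, Prod.mk.injEq] at h <;> omega

lemma pairDet_iterate_pairRot (k : ℕ) (m : ℤ × ℤ × ℤ × ℤ) :
    pairDet (pairRot^[k] m) = pairDet m := by
  induction k with
  | zero => rfl
  | succ k ih => rw [Function.iterate_succ_apply', pairDet_pairRot, ih]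

lemma pairDet_iterate_pairCyc (k : ℕ) (m : ℤ × ℤ × ℤ × ℤ) :
    pairDet (pairCyc^[k] m) = pairDet m := by
  induction k with
  | zero => rfl
  | succ k ih => rw [Function.iterate_succ_apply', pairDet_pairCyc, ih]

lemma pairMul_iterate_pairRot (M c : ℤ × ℤ × ℤ × ℤ) (k : ℕ) :
    pairMul M (pairRot^[k] c) = pairMul (pairTurn^[k] M) c := by
  induction k generalizing M with
  | zero => rfl
  | succ k ih => rw [Function.iterate_succ_apply', pairMul_pairRot, ih, Function.iterate_succ_apply]

lemma formTerm_pairGram_pairMul_iterate_pairCyc (M c : ℤ × ℤ × ℤ × ℤ) (j : ℕ) :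
    formTerm (pairGram (pairMul M (pairCyc^[j] c))) = formTerm (pairGram (pairMul M c)) := by
  induction j with
  | zero => rfl
  | succ j ih =>
    rw [Function.iterate_succ_apply', pairMul_pairCyc, formTerm_pairGram_pairCyc, ih]

/-- Every pair of determinant one is uniquely a rotated and permuted pair of the Stern-Brocot
tree. -/
noncomputable def unimodularEquiv :
    Fin 4 × Fin 3 × List Bool ≃ {m : ℤ × ℤ × ℤ × ℤ // pairDet m = 1} :=
  Equiv.ofBijective
    (fun x => ⟨pairRot^[x.1] (pairCyc^[x.2.1] (pairAt x.2.2)), by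
      rw [pairDet_iterate_pairRot, pairDet_iterate_pairCyc, pairDet_pairAt]⟩) <| by
    refine ⟨fun x y h => injective_pairRot_pairCyc_pairAt (Subtype.ext_iff.1 h), ?_⟩
    rintro ⟨m, hm⟩
    obtain ⟨j, hj1, hj2⟩ := exists_pairCyc_mul_nonneg m hm
    obtain ⟨k, hk⟩ := exists_pairRot_nonneg _ hj1 hj2
    obtain ⟨l, hl⟩ := exists_pairAt_eq _
      (by rw [pairDet_iterate_pairRot, pairDet_iterate_pairCyc, hm]) hk
    refine ⟨(-k, -j, l), Subtype.ext ?_⟩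
    simp only [hl]
    clear hk hl hj1 hj2
    fin_cases k <;> fin_cases j <;> ext <;>
      simp [pairRot, pairCyc, show (-1 : Fin 4) = 3 from rfl, show (-2 : Fin 4) = 2 from rfl,
        show (-3 : Fin 4) = 1 from rfl, show (-1 : Fin 3) = 2 from rfl,
        show (-2 : Fin 3) = 1 from rfl] <;> omega

lemma coe_unimodularEquiv (x : Fin 4 × Fin 3 × List Bool) :
    (unimodularEquiv x : ℤ × ℤ × ℤ × ℤ) = pairRot^[x.1] (pairCyc^[x.2.1] (pairAt x.2.2)) := rfl

lemma tsum_unimodular_formTerm {M : ℤ × ℤ × ℤ × ℤ} (hM : 0 < pairDet M) :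
    ∑' γ : {m : ℤ × ℤ × ℤ × ℤ // pairDet m = 1},
      ENNReal.ofReal (formTerm (pairGram (pairMul M γ))) =
      ENNReal.ofReal (3 * Real.pi / (pairDet M : ℝ) ^ 3) := by
  rw [← unimodularEquiv.tsum_eq]
  simp only [coe_unimodularEquiv, pairMul_iterate_pairRot,
    formTerm_pairGram_pairMul_iterate_pairCyc, pairGram_pairMul_pairAt]
  rw [ENNReal.tsum_prod']
  simp only [ENNReal.tsum_prod', tsum_fintype, Finset.sum_const, Finset.card_univ, Fintype.card_fin, nsmul_eq_mul]
  rw [Fin.sum_univ_four]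
  have hn : (0 : ℝ) < pairDet M := by exact_mod_cast hM
  have hq := isPosForm_pairGram hM
  have h0 : pairGram (pairTurn^[(0 : Fin 4)] M) = pairGram M := rfl
  have h1 : pairGram (pairTurn^[(1 : Fin 4)] M) =
      ((pairGram M).2.2, -(pairGram M).2.1, (pairGram M).1) := by
    ext <;> simp [pairGram, pairTurn]; ring
  have h2 : pairGram (pairTurn^[(2 : Fin 4)] M) = pairGram M := by
    ext <;> simp [pairGram, pairTurn]
  have h3 : pairGram (pairTurn^[(3 : Fin 4)] M) =
      ((pairGram M).2.2, -(pairGram M).2.1, (pairGram M).1) := by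
    ext <;> simp [pairGram, pairTurn]; ring
  have key : _ = ENNReal.ofReal (Real.pi / (2 * (pairDet M : ℝ) ^ 3)) :=
    tsum_formTerm_add_tsum_formTerm (A := (pairGram M).1) (h := (pairGram M).2.1)
      (B := (pairGram M).2.2) hM hq
  rw [h0, h1, h2, h3, add_assoc, ← mul_add, ← mul_add, key,
    ← ENNReal.ofReal_add (by positivity) (by positivity), Nat.cast_ofNat,
    ← ENNReal.ofReal_ofNat, ← ENNReal.ofReal_mul (by positivity)]
  congr 1
  field_simp
  norm_num

/-- The basis of a lattice in Hermite normal form. -/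
def hermitePair (x : ℕ × (Σ d : ℕ, Fin (d + 1))) : ℤ × ℤ × ℤ × ℤ :=
  (x.1 + 1, (x.2.2 : ℕ), 0, x.2.1 + 1)

lemma pairDet_hermitePair (x : ℕ × (Σ d : ℕ, Fin (d + 1))) :
    pairDet (hermitePair x) = (x.1 + 1) * (x.2.1 + 1) := by
  simp [pairDet, hermitePair]

lemma hermitePair_injective {x x' : ℕ × (Σ d : ℕ, Fin (d + 1))} {γ γ' : ℤ × ℤ × ℤ × ℤ}
    (hγ : pairDet γ = 1) (hγ' : pairDet γ' = 1)
    (h : pairMul (hermitePair x) γ = pairMul (hermitePair x') γ') : x = x' ∧ γ = γ' := by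
  obtain ⟨a, d, b, hb⟩ := x
  obtain ⟨a', d', b', hb'⟩ := x'
  obtain ⟨x, y, z, w⟩ := γ
  obtain ⟨x', y', z', w'⟩ := γ'
  simp only [pairDet, pairMul, hermitePair, Prod.mk.injEq, mul_zero, add_zero] at hγ hγ' h
  obtain ⟨h1, h2, h3, h4⟩ := h
  have haa : a = a' := by
    have e1 : (a + 1 : ℤ) ∣ a' + 1 := ⟨x * w' - y' * z, by
      linear_combination (-(a' + 1 : ℤ)) * hγ' - w' * h1 + y' * h3⟩
    have e2 : (a' + 1 : ℤ) ∣ a + 1 := ⟨x' * w - y * z', by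
      linear_combination (-(a + 1 : ℤ)) * hγ + w * h1 - y * h3⟩
    have := Int.le_of_dvd (by omega) e1
    have := Int.le_of_dvd (by omega) e2
    omega
  subst haa
  have ha : (a + 1 : ℤ) ≠ 0 := by omega
  have hx := mul_right_cancel₀ ha h1
  have hz := mul_right_cancel₀ ha h3
  subst hx hz
  have hdd : d = d' := by
    have : (d + 1 : ℤ) = d' + 1 := by
      linear_combination (-(d + 1 : ℤ)) * hγ + (d' + 1 : ℤ) * hγ' + x * h4 - z * h2
    omega
  subst hdd
  have hd : (d + 1 : ℤ) ≠ 0 := by omega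
  have hbb : b = b' := by
    have e : (d + 1 : ℤ) ∣ b - b' := ⟨w * (y' - y) - y * (w' - w), by
      linear_combination (-(b - b' : ℤ)) * hγ + w * h2 - y * h4⟩
    have := Int.eq_zero_of_abs_lt_dvd e (by rw [abs_lt]; omega)
    omega
  subst hbb
  have hy := mul_right_cancel₀ hd (add_left_cancel h2)
  have hw := mul_right_cancel₀ hd (add_left_cancel h4)
  subst hy hw
  exact ⟨rfl, rfl⟩

lemma exists_hermitePair {m : ℤ × ℤ × ℤ × ℤ} (hm : 0 < pairDet m) :
    ∃ x γ, pairDet γ = 1 ∧ pairMul (hermitePair x) γ = m := by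
  obtain ⟨u₁, u₂, v₁, v₂⟩ := m
  simp only [pairDet] at hm
  obtain ⟨x, hx⟩ := Int.gcd_dvd_left u₁ v₁
  obtain ⟨z, hz⟩ := Int.gcd_dvd_right u₁ v₁
  have hbez := Int.gcd_eq_gcd_ab u₁ v₁
  generalize Int.gcdA u₁ v₁ = w at hbez
  generalize hy : Int.gcdB u₁ v₁ = y' at hbez
  obtain ⟨y, rfl⟩ : ∃ y, y' = -y := ⟨-y', by ring⟩
  have hpos : 0 < Int.gcd u₁ v₁ := by
    rw [Nat.pos_iff_ne_zero]
    intro h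
    rw [Int.gcd_eq_zero_iff] at h
    simp [h.1, h.2] at hm
  obtain ⟨a, ha⟩ := Nat.exists_eq_add_of_lt hpos
  rw [zero_add] at ha
  rw [ha] at hx hz hbez
  push_cast at hx hz hbez
  have ha0 : (0 : ℤ) < a + 1 := by omega
  have hdet : x * w - y * z = 1 := by
    apply mul_left_cancel₀ ha0.ne'
    rw [hx, hz] at hbez
    linear_combination -hbez
  have hd : 0 < x * v₂ - z * u₂ := by
    rw [hx, hz] at hm
    exact pos_of_mul_pos_right (a := (a + 1 : ℤ)) (by linarith) ha0.le
  obtain ⟨d, hd'⟩ : ∃ d : ℕ, x * v₂ - z * u₂ = d + 1 :=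
    ⟨(x * v₂ - z * u₂ - 1).toNat, by omega⟩
  rw [hd'] at hd
  obtain ⟨b, hb⟩ := Int.eq_ofNat_of_zero_le (Int.emod_nonneg (w * u₂ - y * v₂) hd.ne')
  have hbd := Int.emod_lt_of_pos (w * u₂ - y * v₂) hd
  have hdiv := Int.emod_add_mul_ediv (w * u₂ - y * v₂) (d + 1)
  generalize (w * u₂ - y * v₂) / (d + 1 : ℤ) = t at hdiv
  rw [hb] at hbd hdiv
  refine ⟨(a, ⟨d, b, by omega⟩), (x, y + t * x, z, w + t * z), ?_, ?_⟩
  · simp only [pairDet]; linear_combination hdet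
  · ext <;> simp only [pairMul, hermitePair]
    · linear_combination -hx
    · linear_combination x * hdiv - y * hd' + u₂ * hdet
    · linear_combination -hz
    · linear_combination z * hdiv - w * hd' + v₂ * hdet

/-- Every positively oriented pair is uniquely a unimodular combination of a pair in Hermite normal
form. -/
noncomputable def hermiteEquiv :
    (ℕ × (Σ d : ℕ, Fin (d + 1))) × {m : ℤ × ℤ × ℤ × ℤ // pairDet m = 1} ≃
      {m : ℤ × ℤ × ℤ × ℤ // 0 < pairDet m} :=
  Equiv.ofBijective
    (fun x => ⟨pairMul (hermitePair x.1) x.2, by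
      rw [pairDet_pairMul, x.2.2, pairDet_hermitePair]; positivity⟩) <| by
    refine ⟨fun x y h => ?_, fun m => ?_⟩
    · have := hermitePair_injective x.2.2 y.2.2 (Subtype.ext_iff.1 h)
      exact Prod.ext this.1 (Subtype.ext this.2)
    · obtain ⟨x, γ, hγ, h⟩ := exists_hermitePair m.2
      exact ⟨(x, ⟨γ, hγ⟩), Subtype.ext h⟩

/-- The ordered triples of nonzero vectors with sum zero, not all collinear. -/
abbrev NoncollinearTriple : Type :=
  {w : (ℤ × ℤ) × (ℤ × ℤ) × (ℤ × ℤ) //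
    w.1 ≠ 0 ∧ w.2.1 ≠ 0 ∧ w.2.2 ≠ 0 ∧ w.1 + w.2.1 + w.2.2 = 0 ∧
    w.1.1 * w.2.1.2 - w.1.2 * w.2.1.1 ≠ 0}

lemma NoncollinearTriple.ext_of_fst_snd {w w' : NoncollinearTriple} (h1 : w.1.1 = w'.1.1)
    (h2 : w.1.2.1 = w'.1.2.1) : w = w' := by
  have h := w.2.2.2.2.1
  have h' := w'.2.2.2.2.1
  rw [h1, h2] at h
  exact Subtype.ext (Prod.ext h1 (Prod.ext h2 (add_left_cancel (h.trans h'.symm))))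

/-- The triple `(u, v, -u - v)`. -/
def noncollinearTripleMk (u v : ℤ × ℤ) (h : u.1 * v.2 - u.2 * v.1 ≠ 0) : NoncollinearTriple :=
  ⟨(u, v, -(u + v)), by
    refine ⟨?_, ?_, ?_, by simp, h⟩
    · rintro rfl; simp at h
    · rintro rfl; simp at h
    · intro h'
      obtain rfl : u = -v := eq_neg_of_add_eq_zero_left (neg_eq_zero.1 h')
      apply h
      simp only [Prod.fst_neg, Prod.snd_neg]
      ring⟩

/-- Every triple comes from a unique positively oriented pair, up to transposition. -/
noncomputable def tripleEquiv :
    Bool × {m : ℤ × ℤ × ℤ × ℤ // 0 < pairDet m} ≃ NoncollinearTriple :=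
  Equiv.ofBijective
    (fun x => bif x.1 then
        noncollinearTripleMk (x.2.1.1, x.2.1.2.1) (x.2.1.2.2.1, x.2.1.2.2.2) x.2.2.ne'
      else
        noncollinearTripleMk (x.2.1.2.2.1, x.2.1.2.2.2) (x.2.1.1, x.2.1.2.1) <| by
          have h := x.2.2
          simp only [pairDet] at h
          exact ne_of_lt (by linarith)) <| by
    constructor
    · rintro ⟨b, ⟨x, y, z, w⟩, h⟩ ⟨b', ⟨x', y', z', w'⟩, h'⟩ e
      simp only [pairDet] at h h'
      cases b <;> cases b' <;>
        simp only [noncollinearTripleMk, cond_true, cond_false, Subtype.mk.injEq,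
          Prod.mk.injEq] at e
      · obtain ⟨⟨rfl, rfl⟩, ⟨rfl, rfl⟩, -⟩ := e; rfl
      · obtain ⟨⟨rfl, rfl⟩, ⟨rfl, rfl⟩, -⟩ := e; linarith
      · obtain ⟨⟨rfl, rfl⟩, ⟨rfl, rfl⟩, -⟩ := e; linarith
      · obtain ⟨⟨rfl, rfl⟩, ⟨rfl, rfl⟩, -⟩ := e; rfl
    · intro w
      rcases lt_or_gt_of_ne w.2.2.2.2.2 with h | h
      · exact ⟨(false, ⟨(w.1.2.1.1, w.1.2.1.2, w.1.1.1, w.1.1.2), by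
          simp only [pairDet]; linarith⟩), NoncollinearTriple.ext_of_fst_snd rfl rfl⟩
      · exact ⟨(true, ⟨(w.1.1.1, w.1.1.2, w.1.2.1.1, w.1.2.1.2), h⟩),
          NoncollinearTriple.ext_of_fst_snd rfl rfl⟩

/-- The summand of the lattice sum. -/
noncomputable def tripleTerm (s : ℝ) (w : (ℤ × ℤ) × (ℤ × ℤ) × (ℤ × ℤ)) : ℝ :=
  (|(w.1.1 * w.2.1.2 - w.1.2 * w.2.1.1 : ℤ)| : ℝ) ^ (-s) / (nsq w.1 * nsq w.2.1 * nsq w.2.2)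

lemma tripleTerm_nonneg (s : ℝ) (w : (ℤ × ℤ) × (ℤ × ℤ) × (ℤ × ℤ)) : 0 ≤ tripleTerm s w := by
  unfold tripleTerm nsq
  positivity

lemma tripleTerm_tripleEquiv (s : ℝ) (x : Bool × {m : ℤ × ℤ × ℤ × ℤ // 0 < pairDet m}) :
    tripleTerm s (tripleEquiv x) =
      (pairDet x.2 : ℝ) ^ (-s) * formTerm (pairGram x.2) := by
  obtain ⟨b, ⟨x, y, z, w⟩, h⟩ := x
  have h' : (0 : ℝ) < (pairDet (x, y, z, w) : ℤ) := by exact_mod_cast h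
  rw [← abs_of_pos h', formTerm, mul_one_div]
  cases b
  · rw [← abs_neg, show (tripleEquiv (false, ⟨(x, y, z, w), h⟩) : (ℤ × ℤ) × (ℤ × ℤ) × (ℤ × ℤ)) =
      ((z, w), (x, y), -((z, w) + (x, y))) from rfl]
    simp only [tripleTerm, pairDet, pairGram, formMid, nsq, Prod.mk_add_mk, Prod.neg_mk]
    push_cast
    congr 2 <;> ring_nf
  · rw [show (tripleEquiv (true, ⟨(x, y, z, w), h⟩) : (ℤ × ℤ) × (ℤ × ℤ) × (ℤ × ℤ)) =
      ((x, y), (z, w), -((x, y) + (z, w))) from rfl]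
    simp only [tripleTerm, pairDet, pairGram, formMid, nsq, Prod.mk_add_mk, Prod.neg_mk]
    push_cast
    congr 1
    ring

lemma tsum_ofReal_tripleTerm (s : ℝ) :
    ∑' w : NoncollinearTriple, ENNReal.ofReal (tripleTerm s w) =
      ENNReal.ofReal (6 * Real.pi) * (∑' a : ℕ, ENNReal.ofReal (((a : ℝ) + 1) ^ (-(s + 3)))) *
        ∑' d : ℕ, ENNReal.ofReal (((d : ℝ) + 1) ^ (-(s + 2))) := by
  have inner (x : ℕ × (Σ d : ℕ, Fin (d + 1))) :
      ∑' γ : {m : ℤ × ℤ × ℤ × ℤ // pairDet m = 1},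
        ENNReal.ofReal ((pairDet (hermiteEquiv (x, γ)) : ℝ) ^ (-s) *
          formTerm (pairGram (hermiteEquiv (x, γ)))) =
      ENNReal.ofReal (3 * Real.pi) * ENNReal.ofReal (((x.1 : ℝ) + 1) ^ (-(s + 3))) *
        ENNReal.ofReal (((x.2.1 : ℝ) + 1) ^ (-(s + 3))) := by
    have hdet : pairDet (hermitePair x) = (x.1 + 1) * (x.2.1 + 1) := pairDet_hermitePair x
    have hpos : 0 < pairDet (hermitePair x) := by rw [hdet]; positivity
    have hγ (γ : {m : ℤ × ℤ × ℤ × ℤ // pairDet m = 1}) :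
        ENNReal.ofReal ((pairDet (hermiteEquiv (x, γ)) : ℝ) ^ (-s) *
          formTerm (pairGram (hermiteEquiv (x, γ)))) =
        ENNReal.ofReal ((pairDet (hermitePair x) : ℝ) ^ (-s)) *
          ENNReal.ofReal (formTerm (pairGram (pairMul (hermitePair x) γ))) := by
      rw [← ENNReal.ofReal_mul (by positivity)]
      change ENNReal.ofReal ((pairDet (pairMul (hermitePair x) γ) : ℝ) ^ (-s) * _) = _
      rw [pairDet_pairMul, γ.2, mul_one]
      rfl
    simp only [hγ]
    rw [ENNReal.tsum_mul_left, tsum_unimodular_formTerm hpos,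
      ← ENNReal.ofReal_mul (by positivity), ← ENNReal.ofReal_mul (by positivity),
      ← ENNReal.ofReal_mul (by positivity), mul_assoc, ← Real.mul_rpow (by positivity)
      (by positivity), hdet]
    push_cast
    have hx : (0 : ℝ) < (x.1 + 1) * (x.2.1 + 1) := by positivity
    congr 1
    rw [neg_add, Real.rpow_add hx, Real.rpow_neg hx.le 3]
    norm_cast
    field_simp
  rw [← tripleEquiv.tsum_eq, ENNReal.tsum_prod']
  simp only [tripleTerm_tripleEquiv, tsum_fintype, Finset.sum_const, Finset.card_univ,
    Fintype.card_bool]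
  rw [← hermiteEquiv.tsum_eq, ENNReal.tsum_prod']
  simp only [inner]
  rw [ENNReal.tsum_prod']
  simp only [ENNReal.tsum_mul_left, ENNReal.tsum_mul_right, ENNReal.tsum_sigma', tsum_fintype,
    Finset.sum_const, Finset.card_univ, Fintype.card_fin, nsmul_eq_mul]
  have hd (d : ℕ) : ((d + 1 : ℕ) : ENNReal) * ENNReal.ofReal (((d : ℝ) + 1) ^ (-(s + 3))) =
      ENNReal.ofReal (((d : ℝ) + 1) ^ (-(s + 2))) := by
    have hd0 : (0 : ℝ) < d + 1 := by positivity
    rw [← ENNReal.ofReal_natCast, ← ENNReal.ofReal_mul (by positivity),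
      show -(s + 2) = 1 + -(s + 3) by ring, Real.rpow_add hd0, Real.rpow_one]
    push_cast
    rfl
  simp only [hd, ← mul_assoc]
  congr 2
  rw [Nat.cast_ofNat, ← ENNReal.ofReal_ofNat, ← ENNReal.ofReal_mul (by positivity)]
  congr 1
  ring

lemma toReal_tsum_ofReal {ι : Type*} {f : ι → ℝ} (hf : ∀ i, 0 ≤ f i) :
    (∑' i, ENNReal.ofReal (f i)).toReal = ∑' i, f i := by
  rw [ENNReal.tsum_toReal_eq fun _ => ENNReal.ofReal_ne_top]
  exact tsum_congr fun i => ENNReal.toReal_ofReal (hf i)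

lemma ofReal_tsum_rpow_neg_eq_riemannZeta {t : ℝ} (ht : 1 < t) :
    ((∑' n : ℕ, ((n : ℝ) + 1) ^ (-t) : ℝ) : ℂ) = riemannZeta t := by
  rw [zeta_eq_tsum_one_div_nat_add_one_cpow (by simpa using ht), Complex.ofReal_tsum]
  refine tsum_congr fun n => ?_
  rw [Complex.ofReal_cpow (by positivity), Complex.ofReal_neg, Complex.cpow_neg, one_div]
  push_cast
  rfl

end Helpers

theorem stmt16 (s : ℝ) (hs : 0 ≤ s) :
    ((∑' w : {w : (ℤ × ℤ) × (ℤ × ℤ) × (ℤ × ℤ) //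
        w.1 ≠ 0 ∧ w.2.1 ≠ 0 ∧ w.2.2 ≠ 0 ∧ w.1 + w.2.1 + w.2.2 = 0 ∧
        w.1.1 * w.2.1.2 - w.1.2 * w.2.1.1 ≠ 0},
      (|(w.1.1.1 * w.1.2.1.2 - w.1.1.2 * w.1.2.1.1 : ℤ)| : ℝ) ^ (-s) /
        (nsq w.1.1 * nsq w.1.2.1 * nsq w.1.2.2) : ℝ) : ℂ)
      = 6 * (Real.pi : ℂ) * riemannZeta (s + 3) * riemannZeta (s + 2) := by
  have h : ∑' w : NoncollinearTriple, tripleTerm s w =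
      6 * Real.pi * (∑' n : ℕ, ((n : ℝ) + 1) ^ (-(s + 3))) *
        ∑' n : ℕ, ((n : ℝ) + 1) ^ (-(s + 2)) := by
    rw [← toReal_tsum_ofReal fun w : NoncollinearTriple => tripleTerm_nonneg s w,
      tsum_ofReal_tripleTerm, ENNReal.toReal_mul, ENNReal.toReal_mul,
      toReal_tsum_ofReal fun _ => by positivity, toReal_tsum_ofReal fun _ => by positivity,
      ENNReal.toReal_ofReal (by positivity)]
  refine (congrArg (fun x : ℝ => (x : ℂ)) h).trans ?_
  have h3 := ofReal_tsum_rpow_neg_eq_riemannZeta (show 1 < s + 3 by linarith)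
  have h2 := ofReal_tsum_rpow_neg_eq_riemannZeta (show 1 < s + 2 by linarith)
  rw [Complex.ofReal_mul, Complex.ofReal_mul, h3, h2]
  push_cast
  rfl
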